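/- For every n ≥ 3, the edge domination number of the pseudofractal scale-free web G_n equals 3^{n-2}. -/

import Mathlib

/-!
Common definitions: the pseudofractal scale-free web `pfw n` (= `G_n` for `n ≥ 1`)
and the Sierpinski graph `sierp n` (= `S_n` for `n ≥ 1`), together with the
edge-domination notions used in the paper.
-/

open scoped Classical

noncomputable section

/-- A finite graph generation: a finite vertex type, a finite set of edges
(unordered pairs of vertices), and three designated hub/outmost vertices. -/
structure GraphGen : Type 1 where
  V : Type
  fin : Fintype V
  edges : Finset (Sym2 V)
  hubs : Fin 3 → V

attribute [instance] GraphGen.fin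

/-- The triangle (complete graph on three vertices), the common first generation. -/
def triangle : GraphGen where
  V := Fin 3
  fin := inferInstance
  edges := {s((0 : Fin 3), (1 : Fin 3)), s((0 : Fin 3), (2 : Fin 3)), s((1 : Fin 3), (2 : Fin 3))}
  hubs := fun i => i

/-- One iteration step of the pseudofractal scale-free web: for every existing
edge `{u,v}` a new vertex is added and joined to both `u` and `v`. -/
def pfwStep (X : GraphGen) : GraphGen where
  V := X.V ⊕ {e : Sym2 X.V // e ∈ X.edges}
  fin := inferInstance
  edges :=
    X.edges.image (Sym2.map Sum.inl) ∪
      X.edges.attach.biUnion fun e =>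
        (Finset.univ.filter fun v : X.V => v ∈ (e : Sym2 X.V)).image fun v =>
          s((Sum.inl v : X.V ⊕ {e : Sym2 X.V // e ∈ X.edges}), Sum.inr e)
  hubs := fun i => Sum.inl (X.hubs i)

private def pfwAux : ℕ → GraphGen
  | 0 => triangle
  | n + 1 => pfwStep (pfwAux n)

/-- `pfw n` is the pseudofractal scale-free web `G_n` (for `n ≥ 1`):
`G_1` is a triangle and `G_{n+1}` is obtained from `G_n` by adding, for each
edge, a new vertex adjacent to both of its endpoints.  Its hubs are the three
vertices of `G_1`. -/
def pfw (n : ℕ) : GraphGen := pfwAux (n - 1)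

/-- The identification relation used to glue three copies of the Sierpinski
graph: `B^(1) ~ A^(2)`, `C^(1) ~ A^(3)`, `C^(2) ~ B^(3)` (copies indexed by
`0, 1, 2` and outmost vertices `A = hubs 0`, `B = hubs 1`, `C = hubs 2`). -/
def sierpRel (X : GraphGen) : Fin 3 × X.V → Fin 3 × X.V → Prop := fun p q =>
  (p = ((0 : Fin 3), X.hubs 1) ∧ q = ((1 : Fin 3), X.hubs 0)) ∨
  (p = ((0 : Fin 3), X.hubs 2) ∧ q = ((2 : Fin 3), X.hubs 0)) ∨
  (p = ((1 : Fin 3), X.hubs 2) ∧ q = ((2 : Fin 3), X.hubs 1))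

/-- One iteration step of the Sierpinski graph: three disjoint copies of the
previous generation are glued along their outmost vertices. -/
def sierpStep (X : GraphGen) : GraphGen where
  V := Quotient (Relation.EqvGen.setoid (sierpRel X))
  fin := inferInstance
  edges :=
    (Finset.univ : Finset (Fin 3)).biUnion fun t =>
      X.edges.image (Sym2.map fun v => Quotient.mk (Relation.EqvGen.setoid (sierpRel X)) (t, v))
  hubs := fun i => Quotient.mk (Relation.EqvGen.setoid (sierpRel X)) (i, X.hubs i)

private def sierpAux : ℕ → GraphGen
  | 0 => triangle
  | n + 1 => sierpStep (sierpAux n)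

/-- `sierp n` is the Sierpinski graph `S_n` (for `n ≥ 1`):
`S_1` is a triangle, and `S_{n+1}` is obtained by gluing three copies of `S_n`
at their outmost vertices.  Its `hubs` are the three outmost vertices. -/
def sierp (n : ℕ) : GraphGen := sierpAux (n - 1)

/-- An edge `e` is dominated by the edge set `F` if it belongs to `F` or
shares an endpoint with some edge of `F`. -/
def Dominated (X : GraphGen) (F : Finset (Sym2 X.V)) (e : Sym2 X.V) : Prop :=
  e ∈ F ∨ ∃ f ∈ F, ∃ v, v ∈ e ∧ v ∈ f

/-- `F` is an edge dominating set: a set of edges of `X` such that every edge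
not in `F` shares an endpoint with some edge of `F`. -/
def IsEDS (X : GraphGen) (F : Finset (Sym2 X.V)) : Prop :=
  F ⊆ X.edges ∧ ∀ e ∈ X.edges, e ∉ F → ∃ f ∈ F, ∃ v, v ∈ e ∧ v ∈ f

/-- The edge domination number: the minimum cardinality of an edge dominating set. -/
def edsNum (X : GraphGen) : ℕ := sInf {k | ∃ F, IsEDS X F ∧ F.card = k}

/-- A minimum edge dominating set: an EDS whose cardinality equals the edge
domination number. -/
def IsMEDS (X : GraphGen) (F : Finset (Sym2 X.V)) : Prop :=
  IsEDS X F ∧ F.card = edsNum X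

/-- Hub number `i` is filled w.r.t. `F`: some edge incident to it lies in `F`. -/
def FilledHub (X : GraphGen) (F : Finset (Sym2 X.V)) (i : Fin 3) : Prop :=
  ∃ f ∈ F, X.hubs i ∈ f

/-- Hub number `i` is cross w.r.t. `F`: no edge incident to it lies in `F` and
some edge incident to it is not dominated by `F`. -/
def CrossHub (X : GraphGen) (F : Finset (Sym2 X.V)) (i : Fin 3) : Prop :=
  ¬ FilledHub X F i ∧ ∃ e ∈ X.edges, X.hubs i ∈ e ∧ ¬ Dominated X F e

/-- Hub number `i` is empty w.r.t. `F`: it is neither filled nor cross. -/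
def EmptyHub (X : GraphGen) (F : Finset (Sym2 X.V)) (i : Fin 3) : Prop :=
  ¬ FilledHub X F i ∧ ¬ CrossHub X F i

/-- `F` is admissible: a set of edges of `X` such that every edge not dominated
by `F` is incident to a cross hub vertex. -/
def Admissible (X : GraphGen) (F : Finset (Sym2 X.V)) : Prop :=
  F ⊆ X.edges ∧
    ∀ e ∈ X.edges, ¬ Dominated X F e → ∃ i, CrossHub X F i ∧ X.hubs i ∈ e

/-- The number of filled hub vertices w.r.t. `F`. -/
def numFilled (X : GraphGen) (F : Finset (Sym2 X.V)) : ℕ :=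
  (Finset.univ.filter fun i : Fin 3 => FilledHub X F i).card

/-- The number of cross hub vertices w.r.t. `F`. -/
def numCross (X : GraphGen) (F : Finset (Sym2 X.V)) : ℕ :=
  (Finset.univ.filter fun i : Fin 3 => CrossHub X F i).card

/-- `minAdm X nf i` is the minimum cardinality of an admissible set with exactly
`nf` filled hub vertices and exactly `i` cross hub vertices. -/
def minAdm (X : GraphGen) (nf i : ℕ) : ℕ :=
  sInf {k | ∃ F, Admissible X F ∧ numFilled X F = nf ∧ numCross X F = i ∧ F.card = k}

/-- The class of admissible sets with exactly `nf` filled and exactly `i` cross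
hub vertices attaining the minimum cardinality among such sets. -/
def admClass (X : GraphGen) (nf i : ℕ) : Set (Finset (Sym2 X.V)) :=
  {F | Admissible X F ∧ numFilled X F = nf ∧ numCross X F = i ∧ F.card = minAdm X nf i}

/-- `a_n^i`: minimum cardinality of an admissible set with no filled hub and `i` cross hubs. -/
def aq (X : GraphGen) (i : ℕ) : ℕ := minAdm X 0 i

/-- `b_n^i`: minimum cardinality of an admissible set with one filled hub and `i` cross hubs. -/
def bq (X : GraphGen) (i : ℕ) : ℕ := minAdm X 1 i

/-- `c_n^i`: minimum cardinality of an admissible set with two filled hubs and `i` cross hubs. -/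
def cq (X : GraphGen) (i : ℕ) : ℕ := minAdm X 2 i

/-- `d_n^i`: minimum cardinality of an admissible set with three filled hubs and `i` cross hubs. -/
def dq (X : GraphGen) (i : ℕ) : ℕ := minAdm X 3 i

end


/-- The vertices of `X`, viewed in `pfwStep X`. -/
def pfwOld (X : GraphGen) (v : X.V) : (pfwStep X).V := Sum.inl v

/-- The vertex of `pfwStep X` added for an edge of `X`. -/
def pfwNew (X : GraphGen) (e : {e : Sym2 X.V // e ∈ X.edges}) : (pfwStep X).V := Sum.inr e

theorem pfwOld_injective (X : GraphGen) : Function.Injective (pfwOld X) := Sum.inl_injective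

theorem pfwNew_injective (X : GraphGen) : Function.Injective (pfwNew X) := Sum.inr_injective

theorem pfwOld_ne_pfwNew {X : GraphGen} (v : X.V) (e : {e : Sym2 X.V // e ∈ X.edges}) :
    pfwOld X v ≠ pfwNew X e := Sum.inl_ne_inr

theorem pfwStep_vertex_cases {X : GraphGen} (y : (pfwStep X).V) :
    (∃ v, y = pfwOld X v) ∨ ∃ e, y = pfwNew X e := by
  rcases y with v | e
  · exact Or.inl ⟨v, rfl⟩
  · exact Or.inr ⟨e, rfl⟩

theorem pfwStep_edges (X : GraphGen) :
    (pfwStep X).edges = X.edges.image (Sym2.map (pfwOld X)) ∪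
      X.edges.attach.biUnion fun e =>
        (Finset.univ.filter fun v : X.V => v ∈ (e : Sym2 X.V)).image fun v =>
          s(pfwOld X v, pfwNew X e) := by
  unfold pfwStep pfwOld pfwNew
  dsimp only
  congr!

theorem mem_pfwStep_edges {X : GraphGen} {f : Sym2 (pfwStep X).V} :
    f ∈ (pfwStep X).edges ↔
      (∃ e ∈ X.edges, f = Sym2.map (pfwOld X) e) ∨
        ∃ (e : {e : Sym2 X.V // e ∈ X.edges}) (v : X.V), v ∈ (e : Sym2 X.V) ∧
          f = s(pfwOld X v, pfwNew X e) := by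
  rw [pfwStep_edges]
  constructor
  · intro h
    rcases Finset.mem_union.1 h with h | h
    · obtain ⟨e, he, rfl⟩ := Finset.mem_image.1 h
      exact Or.inl ⟨e, he, rfl⟩
    · obtain ⟨e, -, h⟩ := Finset.mem_biUnion.1 h
      obtain ⟨v, hv, rfl⟩ := Finset.mem_image.1 h
      exact Or.inr ⟨e, v, (Finset.mem_filter.1 hv).2, rfl⟩
  · rintro (⟨e, he, rfl⟩ | ⟨e, v, hv, rfl⟩)
    · exact Finset.mem_union_left _ (Finset.mem_image_of_mem _ he)
    · exact Finset.mem_union_right _ (Finset.mem_biUnion.2 ⟨e, Finset.mem_attach _ _,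
        Finset.mem_image.2 ⟨v, Finset.mem_filter.2 ⟨Finset.mem_univ _, hv⟩, rfl⟩⟩)

theorem pfwNew_not_mem_map_pfwOld {X : GraphGen} (d : Sym2 X.V)
    (e : {e : Sym2 X.V // e ∈ X.edges}) : pfwNew X e ∉ Sym2.map (pfwOld X) d := by
  intro h
  obtain ⟨x, -, hx⟩ := Sym2.mem_map.1 h
  exact pfwOld_ne_pfwNew x e hx

theorem pfwNew_mem_mk {X : GraphGen} {v : X.V} {d e : {e : Sym2 X.V // e ∈ X.edges}} :
    pfwNew X e ∈ s(pfwOld X v, pfwNew X d) ↔ e = d := by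
  rw [Sym2.mem_iff, (pfwNew_injective X).eq_iff, or_iff_right (pfwOld_ne_pfwNew v e).symm]

theorem pfwOld_mem_mk {X : GraphGen} {v w : X.V} {d : {e : Sym2 X.V // e ∈ X.edges}} :
    pfwOld X w ∈ s(pfwOld X v, pfwNew X d) ↔ w = v := by
  rw [Sym2.mem_iff, (pfwOld_injective X).eq_iff, or_iff_left (pfwOld_ne_pfwNew w d)]

/-- An edge of `pfwStep X` contains at most one new vertex. -/
theorem eq_of_pfwNew_mem_pfwStep_edge {X : GraphGen} {g : Sym2 (pfwStep X).V}
    (hg : g ∈ (pfwStep X).edges) {e e' : {e : Sym2 X.V // e ∈ X.edges}}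
    (h : pfwNew X e ∈ g) (h' : pfwNew X e' ∈ g) : e = e' := by
  rcases mem_pfwStep_edges.1 hg with ⟨d, -, rfl⟩ | ⟨d, v, -, rfl⟩
  · exact absurd h (pfwNew_not_mem_map_pfwOld d e)
  · exact (pfwNew_mem_mk.1 h).trans (pfwNew_mem_mk.1 h').symm

/-- Every edge of `pfwStep X` contains an old vertex. -/
theorem exists_pfwOld_mem_pfwStep_edge {X : GraphGen} {f : Sym2 (pfwStep X).V}
    (hf : f ∈ (pfwStep X).edges) : ∃ v : X.V, pfwOld X v ∈ f := by
  rcases mem_pfwStep_edges.1 hf with ⟨d, -, rfl⟩ | ⟨d, v, -, rfl⟩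
  · exact ⟨_, Sym2.mem_map.2 ⟨_, Sym2.out_fst_mem d, rfl⟩⟩
  · exact ⟨v, Sym2.mem_mk_left _ _⟩

/-- Every edge `f` of `pfwStep Y` lies in the triangle spanned by an edge `g` of `Y` and its
new vertex. -/
theorem exists_parent_of_mem_pfwStep_edges {Y : GraphGen} {f : Sym2 (pfwStep Y).V}
    (hf : f ∈ (pfwStep Y).edges) :
    ∃ g ∈ Y.edges, (∀ y : Y.V, pfwOld Y y ∈ f → y ∈ g) ∧
      ∀ g' : {e : Sym2 Y.V // e ∈ Y.edges}, pfwNew Y g' ∈ f → (g' : Sym2 Y.V) = g := by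
  rcases mem_pfwStep_edges.1 hf with ⟨d, hd, rfl⟩ | ⟨d, v, hv, rfl⟩
  · refine ⟨d, hd, fun y hy => ?_, fun g' hg' => absurd hg' (pfwNew_not_mem_map_pfwOld d g')⟩
    obtain ⟨x, hx, hxy⟩ := Sym2.mem_map.1 hy
    exact pfwOld_injective Y hxy ▸ hx
  · exact ⟨d, d.2, fun y hy => pfwOld_mem_mk.1 hy ▸ hv,
      fun g' hg' => congrArg Subtype.val (pfwNew_mem_mk.1 hg')⟩

theorem card_edges_le_card_of_isEDS {X : GraphGen} {F : Finset (Sym2 (pfwStep (pfwStep X)).V)}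
    (hF : IsEDS (pfwStep (pfwStep X)) F) : X.edges.card ≤ F.card := by
  have key : ∀ e : {e : Sym2 X.V // e ∈ X.edges}, ∃ f ∈ F, ∀ g ∈ (pfwStep X).edges,
      (∀ y, pfwOld (pfwStep X) y ∈ f → y ∈ g) →
      (∀ g', pfwNew (pfwStep X) g' ∈ f → (g' : Sym2 (pfwStep X).V) = g) →
      pfwNew X e ∈ g := by
    intro e
    obtain ⟨u, hu⟩ : ∃ u, u ∈ (e : Sym2 X.V) := ⟨_, Sym2.out_fst_mem _⟩
    let g : {e : Sym2 (pfwStep X).V // e ∈ (pfwStep X).edges} :=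
      ⟨s(pfwOld X u, pfwNew X e), mem_pfwStep_edges.2 (Or.inr ⟨e, u, hu, rfl⟩)⟩
    have hwg : pfwNew X e ∈ (g : Sym2 (pfwStep X).V) := Sym2.mem_mk_right _ _
    let b : Sym2 (pfwStep (pfwStep X)).V :=
      s(pfwOld (pfwStep X) (pfwNew X e), pfwNew (pfwStep X) g)
    have hb : b ∈ (pfwStep (pfwStep X)).edges :=
      mem_pfwStep_edges.2 (Or.inr ⟨g, pfwNew X e, hwg, rfl⟩)
    obtain ⟨f, hf, v, hvb, hvf⟩ : ∃ f ∈ F, ∃ v, v ∈ b ∧ v ∈ f := by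
      by_cases h : b ∈ F
      · exact ⟨b, h, _, Sym2.mem_mk_left _ _, Sym2.mem_mk_left _ _⟩
      · exact hF.2 b hb h
    refine ⟨f, hf, fun p _ h₁ h₂ => ?_⟩
    rcases Sym2.mem_iff.1 hvb with rfl | rfl
    · exact h₁ _ hvf
    · exact h₂ g hvf ▸ hwg
  choose φ hφF hφ using key
  have inj : Function.Injective φ := by
    intro e e' h
    obtain ⟨g, hg, h₁, h₂⟩ := exists_parent_of_mem_pfwStep_edges (hF.1 (hφF e))
    exact eq_of_pfwNew_mem_pfwStep_edge hg (hφ e g hg h₁ h₂) (hφ e' g hg (h ▸ h₁) (h ▸ h₂))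
  rw [← Finset.card_attach]
  exact Finset.card_le_card_of_injOn φ (fun e _ => hφF e) inj.injOn

/-- The edges of `X` can be assigned to incident vertices so that every vertex is hit. -/
def HasIncidentSurjection (X : GraphGen) : Prop :=
  ∃ f : {e : Sym2 X.V // e ∈ X.edges} → X.V,
    (∀ e : {e : Sym2 X.V // e ∈ X.edges}, f e ∈ (e : Sym2 X.V)) ∧ Function.Surjective f

theorem HasIncidentSurjection.exists_isEDS {X : GraphGen} (h : HasIncidentSurjection X) :
    ∃ F, IsEDS (pfwStep (pfwStep X)) F ∧ F.card ≤ X.edges.card := by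
  obtain ⟨f, hf, hsurj⟩ := h
  let ψ : {e : Sym2 X.V // e ∈ X.edges} → Sym2 (pfwStep X).V := fun e =>
    s(pfwOld X (f e), pfwNew X e)
  let φ : {e : Sym2 X.V // e ∈ X.edges} → Sym2 (pfwStep (pfwStep X)).V := fun e =>
    Sym2.map (pfwOld (pfwStep X)) (ψ e)
  have hcov : ∀ y : (pfwStep X).V, ∃ e, y ∈ ψ e := by
    intro y
    rcases pfwStep_vertex_cases y with ⟨v, rfl⟩ | ⟨e, rfl⟩
    · obtain ⟨e, rfl⟩ := hsurj v
      exact ⟨e, Sym2.mem_mk_left _ _⟩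
    · exact ⟨e, Sym2.mem_mk_right _ _⟩
  refine ⟨X.edges.attach.image φ, ⟨?_, ?_⟩, ?_⟩
  · intro d hd
    obtain ⟨e, -, rfl⟩ := Finset.mem_image.1 hd
    exact mem_pfwStep_edges.2
      (Or.inl ⟨ψ e, mem_pfwStep_edges.2 (Or.inr ⟨e, f e, hf e, rfl⟩), rfl⟩)
  · intro d hd _
    obtain ⟨y, hy⟩ := exists_pfwOld_mem_pfwStep_edge hd
    obtain ⟨e, he⟩ := hcov y
    exact ⟨φ e, Finset.mem_image_of_mem _ (Finset.mem_attach _ _), _, hy,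
      Sym2.mem_map.2 ⟨y, he, rfl⟩⟩
  · exact Finset.card_image_le.trans Finset.card_attach.le

theorem HasIncidentSurjection.edsNum_pfwStep_pfwStep {X : GraphGen}
    (h : HasIncidentSurjection X) : edsNum (pfwStep (pfwStep X)) = X.edges.card := by
  obtain ⟨F, hF, hcard⟩ := h.exists_isEDS
  refine le_antisymm (le_trans (Nat.sInf_le ⟨F, hF, rfl⟩) hcard) ?_
  refine le_csInf ⟨F.card, F, hF, rfl⟩ ?_
  rintro k ⟨F', hF', rfl⟩
  exact card_edges_le_card_of_isEDS hF'

theorem mem_triangle_edges {e : Sym2 (Fin 3)} :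
    e ∈ triangle.edges ↔ e = s(0, 1) ∨ e = s(0, 2) ∨ e = s(1, 2) := by
  change e ∈ ({s(0, 1), s(0, 2), s(1, 2)} : Finset (Sym2 (Fin 3))) ↔ _
  simp only [Finset.mem_insert, Finset.mem_singleton]

theorem hasIncidentSurjection_triangle : HasIncidentSurjection triangle := by
  have key : ∀ e : Sym2 (Fin 3), ∃ v : Fin 3, v ∈ e ∧ ∀ w, e = s(w, w + 1) → v = w := by
    intro e
    by_cases h : ∃ w, e = s(w, w + 1)
    · obtain ⟨w, rfl⟩ := h
      refine ⟨w, Sym2.mem_mk_left _ _, ?_⟩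
      revert w
      decide
    · exact ⟨_, Sym2.out_fst_mem e, fun w hw => absurd ⟨w, hw⟩ h⟩
  have hedge : ∀ v : Fin 3, s(v, v + 1) = s(0, 1) ∨ s(v, v + 1) = s(0, 2) ∨
      s(v, v + 1) = s(1, 2) := by
    simp only [Sym2.eq_iff]
    decide
  choose f hf hf' using key
  refine ⟨fun e => f e.1, fun e => hf e.1, fun v : Fin 3 =>
    ⟨⟨s(v, v + 1), mem_triangle_edges.2 (hedge v)⟩, hf' _ v rfl⟩⟩

theorem HasIncidentSurjection.pfwStep {X : GraphGen} (h : HasIncidentSurjection X) :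
    HasIncidentSurjection (pfwStep X) := by
  obtain ⟨f, hf, hsurj⟩ := h
  have key : ∀ d : {d : Sym2 (_root_.pfwStep X).V // d ∈ (_root_.pfwStep X).edges},
      ∃ y ∈ (d : Sym2 (_root_.pfwStep X).V),
        (∀ e : {e : Sym2 X.V // e ∈ X.edges}, (d : Sym2 (_root_.pfwStep X).V) =
          Sym2.map (pfwOld X) (e : Sym2 X.V) → y = pfwOld X (f e)) ∧
        ∀ e, pfwNew X e ∈ (d : Sym2 (_root_.pfwStep X).V) → y = pfwNew X e := by
    rintro ⟨d, hd⟩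
    rcases mem_pfwStep_edges.1 hd with ⟨e, he, rfl⟩ | ⟨e, v, -, rfl⟩
    · refine ⟨pfwOld X (f ⟨e, he⟩), Sym2.mem_map.2 ⟨_, hf ⟨e, he⟩, rfl⟩, fun e' h => ?_,
        fun e' h => absurd h (pfwNew_not_mem_map_pfwOld e e')⟩
      have : e = e' := Sym2.map.injective (pfwOld_injective X) h
      subst this
      rfl
    · refine ⟨pfwNew X e, Sym2.mem_mk_right _ _, fun e' h => ?_,
        fun e' h => congrArg _ (pfwNew_mem_mk.1 h).symm⟩
      exact absurd (h ▸ Sym2.mem_mk_right _ _) (pfwNew_not_mem_map_pfwOld (e' : Sym2 X.V) e)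
  choose φ hφ hold hnew using key
  refine ⟨φ, hφ, fun y => ?_⟩
  rcases pfwStep_vertex_cases y with ⟨v, rfl⟩ | ⟨e, rfl⟩
  · obtain ⟨e, rfl⟩ := hsurj v
    exact ⟨⟨Sym2.map (pfwOld X) e, mem_pfwStep_edges.2 (Or.inl ⟨e, e.2, rfl⟩)⟩, hold _ e rfl⟩
  · exact ⟨⟨s(pfwOld X (f e), pfwNew X e), mem_pfwStep_edges.2 (Or.inr ⟨e, f e, hf e, rfl⟩)⟩,
      hnew _ e (Sym2.mem_mk_right _ _)⟩

theorem card_filter_mem_sym2 {V : Type*} [Fintype V] (e : Sym2 V) (he : ¬ e.IsDiag) :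
    (Finset.univ.filter fun v : V => v ∈ e).card = 2 := by
  rw [← Sym2.card_toFinset_of_not_isDiag e he]
  congr 1
  ext v
  simp

theorem not_isDiag_of_mem_pfwStep_edges {X : GraphGen} (h : ∀ e ∈ X.edges, ¬ e.IsDiag) :
    ∀ e ∈ (pfwStep X).edges, ¬ e.IsDiag := by
  intro d hd
  rcases mem_pfwStep_edges.1 hd with ⟨e, he, rfl⟩ | ⟨e, v, -, rfl⟩
  · rw [Sym2.isDiag_map (pfwOld_injective X)]
    exact h e he
  · exact fun hdiag => pfwOld_ne_pfwNew v e (Sym2.mk_isDiag_iff.1 hdiag)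

theorem card_pfwStep_edges {X : GraphGen} (h : ∀ e ∈ X.edges, ¬ e.IsDiag) :
    (pfwStep X).edges.card = 3 * X.edges.card := by
  rw [pfwStep_edges, Finset.card_union_of_disjoint,
    Finset.card_image_of_injective _ (Sym2.map.injective (pfwOld_injective X)),
    Finset.card_biUnion]
  · rw [Finset.sum_congr rfl (g := fun _ => 2), Finset.sum_const, Finset.card_attach, smul_eq_mul]
    · omega
    · intro e _
      rw [Finset.card_image_of_injective, card_filter_mem_sym2 _ (h e e.2)]
      intro v v' hv
      exact pfwOld_injective X (Sym2.congr_left.1 hv)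
  · intro e _ e' _ hne
    refine Finset.disjoint_left.2 ?_
    intro d hd hd'
    obtain ⟨v, -, rfl⟩ := Finset.mem_image.1 hd
    obtain ⟨v', -, hv⟩ := Finset.mem_image.1 hd'
    exact hne (pfwNew_mem_mk.1 (hv ▸ Sym2.mem_mk_right _ _ : pfwNew X e' ∈ _)).symm
  · rw [Finset.disjoint_left]
    intro d hd hd'
    obtain ⟨e, -, rfl⟩ := Finset.mem_image.1 hd
    obtain ⟨e', -, hd'⟩ := Finset.mem_biUnion.1 hd'
    obtain ⟨v, -, hv⟩ := Finset.mem_image.1 hd'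
    exact pfwNew_not_mem_map_pfwOld e e' (hv ▸ Sym2.mem_mk_right _ _)

private theorem pfwAux_properties (n : ℕ) :
    HasIncidentSurjection (pfwAux n) ∧ (∀ e ∈ (pfwAux n).edges, ¬ e.IsDiag) ∧
      (pfwAux n).edges.card = 3 ^ (n + 1) := by
  induction n with
  | zero =>
    refine ⟨hasIncidentSurjection_triangle, fun e he => ?_, ?_⟩
    · rcases mem_triangle_edges.1 he with rfl | rfl | rfl <;>
        exact fun h => absurd (Sym2.mk_isDiag_iff.1 h) (by decide : (_ : Fin 3) ≠ _)
    · have : triangle.edges = ({s(0, 1), s(0, 2), s(1, 2)} : Finset (Sym2 (Fin 3))) := by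
        have h : ∀ e : Sym2 (Fin 3), (e = s(0, 1) ∨ e = s(0, 2) ∨ e = s(1, 2)) ↔
            e ∈ ({s(0, 1), s(0, 2), s(1, 2)} : Finset (Sym2 (Fin 3))) := by
          simp only [Finset.mem_insert, Finset.mem_singleton, implies_true]
        exact Finset.ext fun e => mem_triangle_edges.trans (h e)
      change triangle.edges.card = 3
      rw [this]
      decide
  | succ n ih =>
    obtain ⟨h₁, h₂, h₃⟩ := ih
    refine ⟨h₁.pfwStep, not_isDiag_of_mem_pfwStep_edges h₂, ?_⟩
    change (pfwStep (pfwAux n)).edges.card = _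
    rw [card_pfwStep_edges h₂, h₃, pow_succ' 3 (n + 1)]

/-- for every `n ≥ 3`, the edge domination number of the
pseudofractal scale-free web `G_n` equals `3^(n-2)`. -/
theorem pfw_edsNum (n : ℕ) (hn : 3 ≤ n) :
    edsNum (pfw n) = 3 ^ (n - 2) := by
  obtain ⟨m, rfl⟩ := Nat.exists_eq_add_of_le' hn
  obtain ⟨h, -, hcard⟩ := pfwAux_properties m
  exact h.edsNum_pfwStep_pfwStep.trans hcard
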